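/- Let a ≥ 0 and n ∈ ℕ, and let u_{n,r}^a(x) = K_n^a((t−x)^r;x) denote the r-th order central moment of the generalized Baskakov Kantorovich operator. Then for all x ≥ 0: u_{n,0}^a(x) = 1, u_{n,1}^a(x) = (1/(n+1))·(−x + ax/(1+x) + 1/2), u_{n,2}^a(x) = (1/(n+1)²)·{nx(x+1) − x(1−x) + (ax/(1+x))·(ax/(1+x) + 2(1−x)) + 1/3}; moreover, for each fixed x ∈ (0,∞) and r ∈ ℕ₀, u_{n,r}^a(x) = O(n^{−⌊(r+1)/2⌋}) as n → ∞. -/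

import Mathlib

open MeasureTheory Filter

noncomputable section

/-- Rising factorial `(n)_i = n(n+1)⋯(n+i-1)`, with `(n)_0 = 1`. -/
def risingFac (n : ℕ) : ℕ → ℝ
  | 0 => 1
  | i + 1 => risingFac n i * ((n : ℝ) + i)

/-- `P_k(n,a) = Σ_{i=0}^{k} C(k,i) (n)_i a^(k-i)`. -/
def Pba (k n : ℕ) (a : ℝ) : ℝ :=
  ∑ i ∈ Finset.range (k + 1), (k.choose i : ℝ) * risingFac n i * a ^ (k - i)

/-- Generalized Baskakov basis function `W_{n,k}^a(x)`. -/
def Wgb (a : ℝ) (n k : ℕ) (x : ℝ) : ℝ :=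
  Real.exp (-(a * x) / (1 + x)) * (Pba k n a / (Nat.factorial k : ℝ)) * x ^ k /
    (1 + x) ^ (n + k)

/-- Generalized Baskakov–Kantorovich operator `K_n^a(f;x)`. -/
def Kgb (a : ℝ) (n : ℕ) (f : ℝ → ℝ) (x : ℝ) : ℝ :=
  ((n : ℝ) + 1) * ∑' k : ℕ,
    Wgb a n k x * ∫ t in ((k : ℝ) / ((n : ℝ) + 1))..(((k : ℝ) + 1) / ((n : ℝ) + 1)), f t


/-- `r`-th order central moment `u_{n,r}^a(x) = K_n^a((t−x)^r;x)`. -/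
def uMoment (a : ℝ) (n r : ℕ) (x : ℝ) : ℝ :=
  Kgb a n (fun t => (t - x) ^ r) x

theorem risingFac_succ_right (n i : ℕ) : risingFac n (i + 1) = n * risingFac (n + 1) i := by
  induction i with
  | zero => simp [risingFac]
  | succ i ih =>
    rw [risingFac, ih, risingFac]
    push_cast
    ring

theorem risingFac_pascal (n i : ℕ) :
    risingFac (n + 1) (i + 1) = (i + 1) * risingFac (n + 1) i + risingFac n (i + 1) := by
  rw [risingFac_succ_right n i, risingFac]
  push_cast
  ring

theorem risingFac_nonneg (n i : ℕ) : 0 ≤ risingFac n i := by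
  induction i with
  | zero => simp [risingFac]
  | succ i ih => rw [risingFac]; positivity

theorem Pba_div_factorial (k n : ℕ) (a : ℝ) :
    Pba k n a / (k.factorial : ℝ) = ∑ i ∈ Finset.range (k + 1),
      risingFac n i / (i.factorial : ℝ) * (a ^ (k - i) / ((k - i).factorial : ℝ)) := by
  rw [Pba, Finset.sum_div]
  refine Finset.sum_congr rfl fun i hi => ?_
  have hik : i ≤ k := Nat.lt_succ_iff.mp (Finset.mem_range.mp hi)
  rw [Nat.cast_choose ℝ hik]
  have := Nat.factorial_ne_zero k
  field_simp

theorem Pba_nonneg (k n : ℕ) {a : ℝ} (ha : 0 ≤ a) : 0 ≤ Pba k n a :=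
  Finset.sum_nonneg fun i _ => by
    have := risingFac_nonneg n i
    positivity

theorem Pba_zero_left (n : ℕ) (a : ℝ) : Pba 0 n a = 1 := by
  simp [Pba, risingFac]

theorem Pba_div_factorial_succ (k n : ℕ) (a : ℝ) :
    Pba (k + 1) (n + 1) a / ((k + 1).factorial : ℝ) =
      Pba k (n + 1) a / (k.factorial : ℝ) + Pba (k + 1) n a / ((k + 1).factorial : ℝ) := by
  simp only [Pba_div_factorial]
  rw [Finset.sum_range_succ' _ (k + 1), Finset.sum_range_succ' _ (k + 1), ← add_assoc,
    ← Finset.sum_add_distrib]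
  congr 1
  refine Finset.sum_congr rfl fun i _ => ?_
  rw [Nat.add_sub_add_right, risingFac_pascal, Nat.factorial_succ i]
  push_cast
  field_simp

theorem Pba_zero_right (k : ℕ) (a : ℝ) : Pba k 0 a = a ^ k := by
  rw [Pba, Finset.sum_range_succ', Finset.sum_eq_zero]
  · simp [risingFac]
  · intro i _
    simp [risingFac_succ_right]

theorem Wgb_nonneg {a : ℝ} (ha : 0 ≤ a) (n k : ℕ) {x : ℝ} (hx : 0 ≤ x) : 0 ≤ Wgb a n k x := by
  have := Pba_nonneg k n ha
  unfold Wgb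
  positivity

theorem Wgb_zero_left (a : ℝ) (k : ℕ) (x : ℝ) :
    Wgb a 0 k x =
      Real.exp (-(a * x / (1 + x))) * ((a * x / (1 + x)) ^ k / (k.factorial : ℝ)) := by
  rw [Wgb, Pba_zero_right, zero_add, neg_div, div_pow, mul_pow]
  ring

theorem Wgb_succ_zero (a : ℝ) (n : ℕ) {x : ℝ} (hx : 0 ≤ x) :
    (1 + x) * Wgb a (n + 1) 0 x = Wgb a n 0 x := by
  have : 1 + x ≠ 0 := by positivity
  simp only [Wgb, Pba_zero_left]
  field_simp
  ring

theorem Wgb_succ_succ (a : ℝ) (n k : ℕ) {x : ℝ} (hx : 0 ≤ x) :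
    (1 + x) * Wgb a (n + 1) (k + 1) x = x * Wgb a (n + 1) k x + Wgb a n (k + 1) x := by
  have : 1 + x ≠ 0 := by positivity
  simp only [Wgb, Pba_div_factorial_succ]
  generalize Pba k (n + 1) a / (k.factorial : ℝ) = A
  generalize Pba (k + 1) n a / ((k + 1).factorial : ℝ) = B
  rw [show n + 1 + (k + 1) = n + k + 2 by ring, show n + 1 + k = n + k + 1 by ring,
    show n + (k + 1) = n + k + 1 by ring]
  field_simp
  ring

theorem summable_of_succ_eq_mul_add {u v : ℕ → ℝ} {c : ℝ} (hc : 0 ≤ c) (hc1 : c < 1)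
    (hu : ∀ k, 0 ≤ u k) (hv : ∀ k, 0 ≤ v k) (hvs : Summable v) (h0 : u 0 = v 0)
    (hsucc : ∀ k, u (k + 1) = c * u k + v (k + 1)) : Summable u := by
  refine summable_of_sum_range_le (c := (∑' k, v k) / (1 - c)) hu fun N => ?_
  have hpos : 0 < 1 - c := by linarith
  rw [le_div_iff₀ hpos]
  cases N with
  | zero => simpa using tsum_nonneg hv
  | succ N =>
    have h1 : ∑ k ∈ Finset.range (N + 1), u k =
        c * ∑ k ∈ Finset.range N, u k + ∑ k ∈ Finset.range (N + 1), v k := by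
      rw [Finset.sum_range_succ', Finset.sum_range_succ' v, h0, Finset.mul_sum,
        ← add_assoc, ← Finset.sum_add_distrib]
      simp only [hsucc]
    have h2 : ∑ k ∈ Finset.range N, u k ≤ ∑ k ∈ Finset.range (N + 1), u k := by
      rw [Finset.sum_range_succ]
      linarith [hu N]
    have h3 := hvs.sum_le_tsum (Finset.range (N + 1)) fun k _ => hv k
    nlinarith [mul_le_mul_of_nonneg_left h2 hc]

theorem summable_Wgb_mul_pow {a : ℝ} (ha : 0 ≤ a) (n : ℕ) {x : ℝ} (hx : 0 ≤ x) :
    Summable fun k => Wgb a n k x * (1 + 1 / (1 + x)) ^ k := by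
  have hx1 : 0 < 1 + x := by linarith
  induction n with
  | zero =>
    have h := (Real.summable_pow_div_factorial
      (a * x / (1 + x) * (1 + 1 / (1 + x)))).mul_left (Real.exp (-(a * x / (1 + x))))
    refine h.congr fun k => ?_
    rw [Wgb_zero_left, mul_pow]
    ring
  | succ n ih =>
    refine summable_of_succ_eq_mul_add (c := x / (1 + x) * (1 + 1 / (1 + x)))
      (v := fun k => (1 + x)⁻¹ * (Wgb a n k x * (1 + 1 / (1 + x)) ^ k)) (by positivity) ?_
      (fun k => ?_) (fun k => ?_) (ih.mul_left _) ?_ (fun k => ?_)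
    · rw [show x / (1 + x) * (1 + 1 / (1 + x)) = x * (x + 2) / (1 + x) ^ 2 by field_simp; ring,
        div_lt_one (by positivity)]
      nlinarith
    · have := Wgb_nonneg ha (n + 1) k hx
      positivity
    · have := Wgb_nonneg ha n k hx
      positivity
    · rw [← Wgb_succ_zero a n hx]
      field_simp
    · have hW := Wgb_succ_succ a n k hx
      rw [mul_comm (1 + x), ← eq_div_iff hx1.ne'] at hW
      rw [hW]
      generalize 1 + 1 / (1 + x) = s
      field_simp
      ring

theorem summable_Wgb_mul_add_pow {a : ℝ} (ha : 0 ≤ a) (n : ℕ) {x : ℝ} (hx : 0 ≤ x)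
    (b : ℝ) (r : ℕ) : Summable fun k : ℕ => Wgb a n k x * ((k : ℝ) + b) ^ r := by
  set s : ℝ := 1 + 1 / (1 + x) with hs
  have hs1 : 1 < s := by
    have : 0 < 1 / (1 + x) := by positivity
    linarith
  have ht : 0 < Real.log s := Real.log_pos hs1
  refine Summable.of_norm_bounded (g := fun k => (r.factorial / Real.log s ^ r *
    Real.exp (Real.log s * |b|)) * (Wgb a n k x * s ^ k))
    ((summable_Wgb_mul_pow ha n hx).mul_left _) fun k => ?_
  have h0 := Wgb_nonneg ha n k hx
  rw [norm_mul, Real.norm_of_nonneg h0, norm_pow, Real.norm_eq_abs]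
  have h1 : |(k : ℝ) + b| ≤ k + |b| := (abs_add_le _ _).trans (by simp)
  have h2 := Real.pow_div_factorial_le_exp (Real.log s * (k + |b|)) (by positivity) r
  have h3 : Real.exp (Real.log s * (k + |b|)) = Real.exp (Real.log s * |b|) * s ^ k := by
    rw [mul_add, Real.exp_add, mul_comm (Real.log s) (k : ℝ), Real.exp_nat_mul,
      Real.exp_log (by linarith), mul_comm]
  rw [h3, mul_pow, div_le_iff₀ (by positivity)] at h2
  have h4 : |(k : ℝ) + b| ^ r ≤
      r.factorial / Real.log s ^ r * Real.exp (Real.log s * |b|) * s ^ k := by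
    refine (pow_le_pow_left₀ (abs_nonneg _) h1 r).trans ?_
    rw [div_mul_eq_mul_div, div_mul_eq_mul_div, le_div_iff₀ (by positivity)]
    linarith
  calc _ ≤ _ := mul_le_mul_of_nonneg_left h4 h0
    _ = _ := by ring

/-- Moments of the discrete weights `W_{n,k}^a(x)` about the point `(n+1)x`. -/
def wMoment (a x : ℝ) (r n : ℕ) : ℝ :=
  ∑' k : ℕ, Wgb a n k x * ((k : ℝ) - (n + 1) * x) ^ r

theorem hasSum_wMoment {a : ℝ} (ha : 0 ≤ a) {x : ℝ} (hx : 0 ≤ x) (r n : ℕ) :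
    HasSum (fun k : ℕ => Wgb a n k x * ((k : ℝ) - (n + 1) * x) ^ r) (wMoment a x r n) := by
  have := summable_Wgb_mul_add_pow ha n hx (-((n + 1) * x)) r
  simp only [← sub_eq_add_neg] at this
  exact this.hasSum

theorem hasSum_Wgb_mul_add_pow {a : ℝ} (ha : 0 ≤ a) {x : ℝ} (hx : 0 ≤ x) (r n : ℕ) (y : ℝ) :
    HasSum (fun k : ℕ => Wgb a n k x * ((k : ℝ) - (n + 1) * x + y) ^ r)
      (∑ j ∈ Finset.range (r + 1), (r.choose j : ℝ) * y ^ (r - j) * wMoment a x j n) := by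
  have h := hasSum_sum (s := Finset.range (r + 1)) fun j _ =>
    (hasSum_wMoment ha hx j n).mul_left ((r.choose j : ℝ) * y ^ (r - j))
  refine h.congr_fun ?_
  intro k
  rw [add_pow, Finset.mul_sum]
  exact Finset.sum_congr rfl fun j _ => by ring

theorem wMoment_recurrence {a : ℝ} (ha : 0 ≤ a) {x : ℝ} (hx : 0 ≤ x) (r n : ℕ) :
    (1 + x) * wMoment a x r (n + 1) =
      x * (∑ j ∈ Finset.range (r + 1), (r.choose j : ℝ) * wMoment a x j (n + 1)) +
      ∑ j ∈ Finset.range (r + 1), (r.choose j : ℝ) * (-x) ^ (r - j) * wMoment a x j n := by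
  have hL := (hasSum_wMoment ha hx r (n + 1)).mul_left (1 + x)
  have hA := (hasSum_Wgb_mul_add_pow ha hx r (n + 1) 1).mul_left x
  have hB := hasSum_Wgb_mul_add_pow ha hx r n (-x)
  simp only [one_pow, mul_one] at hA
  rw [← hasSum_nat_add_iff' 1] at hL hB
  have h := (hA.add hB).congr_fun (g := fun k : ℕ =>
    (1 + x) * (Wgb a (n + 1) (k + 1) x *
      (((k + 1 : ℕ) : ℝ) - (((n + 1 : ℕ) : ℝ) + 1) * x) ^ r)) ?_
  · have h' := hL.unique h
    have h0 := Wgb_succ_zero a n hx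
    simp only [Finset.sum_range_one] at h'
    rw [← mul_assoc, h0] at h'
    push_cast at h'
    rw [show (0 : ℝ) - (n + 1) * x + -x = 0 - (n + 1 + 1) * x by ring] at h'
    linarith
  · intro k
    rw [← mul_assoc, Wgb_succ_succ a n k hx]
    push_cast
    ring

theorem wMoment_succ_sub {a : ℝ} (ha : 0 ≤ a) {x : ℝ} (hx : 0 ≤ x) (r n : ℕ) :
    wMoment a x r (n + 1) - wMoment a x r n =
      x * (∑ j ∈ Finset.range r, (r.choose j : ℝ) * wMoment a x j (n + 1)) +
      ∑ j ∈ Finset.range r, (r.choose j : ℝ) * (-x) ^ (r - j) * wMoment a x j n := by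
  have h := wMoment_recurrence ha hx r n
  rw [Finset.sum_range_succ, Finset.sum_range_succ _ r] at h
  simp only [Nat.choose_self, Nat.cast_one, Nat.sub_self, pow_zero, one_mul] at h
  linarith

theorem wMoment_succ_succ_sub {a : ℝ} (ha : 0 ≤ a) {x : ℝ} (hx : 0 ≤ x) (r n : ℕ) :
    wMoment a x (r + 1) (n + 1) - wMoment a x (r + 1) n =
      (r + 1) * x * (wMoment a x r (n + 1) - wMoment a x r n) +
      ∑ j ∈ Finset.range r, ((r + 1).choose j : ℝ) *
        (x * wMoment a x j (n + 1) + (-x) ^ (r + 1 - j) * wMoment a x j n) := by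
  rw [wMoment_succ_sub ha hx (r + 1), Finset.sum_range_succ, Finset.sum_range_succ _ r]
  simp only [Nat.choose_succ_self_right, Nat.add_sub_cancel_left, pow_one, mul_add,
    Finset.sum_add_distrib, Finset.mul_sum]
  have h1 : ∀ j ∈ Finset.range r, x * (((r + 1).choose j : ℝ) * wMoment a x j (n + 1)) =
      ((r + 1).choose j : ℝ) * (x * wMoment a x j (n + 1)) := fun j _ => by ring
  rw [Finset.sum_congr rfl h1]
  push_cast
  simp only [mul_assoc]
  ring

theorem hasSum_poisson_mul_nat (y : ℝ) {f : ℕ → ℝ} {m : ℝ}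
    (h : HasSum (fun k : ℕ => y ^ k / (k.factorial : ℝ) * f (k + 1)) m) :
    HasSum (fun k : ℕ => y ^ k / (k.factorial : ℝ) * (k * f k)) (y * m) := by
  rw [← hasSum_nat_add_iff' 1]
  simp only [Finset.sum_range_one, Nat.cast_zero, zero_mul, mul_zero, sub_zero]
  refine (h.mul_left y).congr_fun fun k => ?_
  rw [Nat.factorial_succ]
  push_cast
  field_simp
  ring

theorem wMoment_zero (a x : ℝ) :
    wMoment a x 0 0 = 1 ∧ wMoment a x 1 0 = a * x / (1 + x) - x ∧
      wMoment a x 2 0 = a * x / (1 + x) + (a * x / (1 + x) - x) ^ 2 := by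
  simp only [wMoment, Wgb_zero_left]
  generalize a * x / (1 + x) = y
  have hexp : Real.exp (-y) * Real.exp y = 1 := by rw [← Real.exp_add]; simp
  have h0 : HasSum (fun k : ℕ => y ^ k / (k.factorial : ℝ)) (Real.exp y) := by
    rw [Real.exp_eq_exp_ℝ]
    exact NormedSpace.expSeries_div_hasSum_exp y
  have h1 : HasSum (fun k : ℕ => y ^ k / (k.factorial : ℝ) * ((k : ℝ) * 1))
      (y * Real.exp y) := hasSum_poisson_mul_nat y (f := fun _ => 1) (by simpa using h0)
  have h2 : HasSum (fun k : ℕ => y ^ k / (k.factorial : ℝ) * ((k : ℝ) * k))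
      (y * (y * Real.exp y + Real.exp y)) :=
    hasSum_poisson_mul_nat y (f := fun k => (k : ℝ))
      ((h1.add h0).congr_fun fun k => by push_cast; ring)
  refine ⟨?_, ?_, ?_⟩
  · refine HasSum.tsum_eq ?_
    have := h0.mul_left (Real.exp (-y))
    rw [hexp] at this
    simpa using this
  · refine HasSum.tsum_eq ?_
    have hv : Real.exp (-y) * (y * Real.exp y - x * Real.exp y) = y - x := by
      linear_combination (y - x) * hexp
    rw [← hv]
    exact ((h1.sub (h0.mul_left x)).mul_left (Real.exp (-y))).congr_fun fun k => by
      push_cast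
      ring
  · refine HasSum.tsum_eq ?_
    have hv : Real.exp (-y) * (y * (y * Real.exp y + Real.exp y) -
        2 * x * (y * Real.exp y) + x ^ 2 * Real.exp y) = y + (y - x) ^ 2 := by
      linear_combination (y + (y - x) ^ 2) * hexp
    rw [← hv]
    exact (((h2.sub (h1.mul_left (2 * x))).add (h0.mul_left (x ^ 2))).mul_left
      (Real.exp (-y))).congr_fun fun k => by
        push_cast
        ring

theorem wMoment_order_zero {a : ℝ} (ha : 0 ≤ a) {x : ℝ} (hx : 0 ≤ x) (n : ℕ) :
    wMoment a x 0 n = 1 := by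
  induction n with
  | zero => exact (wMoment_zero a x).1
  | succ n ih =>
    have := wMoment_succ_sub ha hx 0 n
    simp only [Finset.range_zero, Finset.sum_empty] at this
    linarith

theorem wMoment_order_one {a : ℝ} (ha : 0 ≤ a) {x : ℝ} (hx : 0 ≤ x) (n : ℕ) :
    wMoment a x 1 n = a * x / (1 + x) - x := by
  induction n with
  | zero => exact (wMoment_zero a x).2.1
  | succ n ih =>
    have := wMoment_succ_succ_sub ha hx 0 n
    simp only [Finset.range_zero, Finset.sum_empty, wMoment_order_zero ha hx] at this
    linarith

theorem wMoment_order_two {a : ℝ} (ha : 0 ≤ a) {x : ℝ} (hx : 0 ≤ x) (n : ℕ) :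
    wMoment a x 2 n =
      n * (x * (1 + x)) + a * x / (1 + x) + (a * x / (1 + x) - x) ^ 2 := by
  induction n with
  | zero => rw [(wMoment_zero a x).2.2]; simp
  | succ n ih =>
    have := wMoment_succ_succ_sub ha hx 1 n
    simp [wMoment_order_zero ha hx, wMoment_order_one ha hx] at this
    push_cast
    linarith

theorem succ_pow_sub_pow_mono (n : ℕ) :
    Monotone fun m : ℕ => ((n : ℝ) + 2) ^ m - ((n : ℝ) + 1) ^ m := by
  refine monotone_nat_of_le_succ fun m => ?_
  have h : ((n : ℝ) + 1) ^ m ≤ ((n : ℝ) + 2) ^ m := by gcongr; norm_num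
  have hn : (0 : ℝ) ≤ n := n.cast_nonneg
  have hp : (0 : ℝ) ≤ ((n : ℝ) + 2) ^ m := by positivity
  simp only [pow_succ]
  nlinarith [mul_le_mul_of_nonneg_right h hn]

theorem pow_le_succ_pow_sub_pow (n m : ℕ) :
    ((n : ℝ) + 2) ^ m ≤ ((n : ℝ) + 2) ^ (m + 1) - ((n : ℝ) + 1) ^ (m + 1) := by
  have h : ((n : ℝ) + 1) ^ m ≤ ((n : ℝ) + 2) ^ m := by gcongr; norm_num
  have hn : (0 : ℝ) ≤ (n : ℝ) + 1 := by positivity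
  simp only [pow_succ]
  nlinarith [mul_le_mul_of_nonneg_right h hn]

theorem wMoment_bounds {a : ℝ} (ha : 0 ≤ a) {x : ℝ} (hx : 0 ≤ x) (r : ℕ) :
    ∃ E : ℝ, 0 ≤ E ∧ (∀ n : ℕ, |wMoment a x r n| ≤ E * ((n : ℝ) + 1) ^ (r / 2)) ∧
      ∀ n : ℕ, |wMoment a x r (n + 1) - wMoment a x r n| ≤
        E * (((n : ℝ) + 2) ^ (r / 2) - ((n : ℝ) + 1) ^ (r / 2)) := by
  induction r using Nat.strong_induction_on with
  | _ r ih =>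
  cases r with
  | zero => exact ⟨1, zero_le_one, by simp [wMoment_order_zero ha hx]⟩
  | succ r =>
    choose! E hE0 hE hΔ using ih
    set D : ℝ := (r + 1) * x * E r + ∑ j ∈ Finset.range r,
      ((r + 1).choose j : ℝ) * (x * E j + x ^ (r + 1 - j) * E j) with hD
    have hD0 : 0 ≤ D := by
      have := hE0 r r.lt_succ_self
      refine add_nonneg (by positivity) (Finset.sum_nonneg fun j hj => ?_)
      have := hE0 j ((Finset.mem_range.mp hj).trans r.lt_succ_self)
      positivity
    have hdiff : ∀ n : ℕ, |wMoment a x (r + 1) (n + 1) - wMoment a x (r + 1) n| ≤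
        D * (((n : ℝ) + 2) ^ ((r + 1) / 2) - ((n : ℝ) + 1) ^ ((r + 1) / 2)) := by
      intro n
      rw [wMoment_succ_succ_sub ha hx, hD, add_mul (_ * E r), Finset.sum_mul]
      refine (abs_add_le _ _).trans (add_le_add ?_
        ((Finset.abs_sum_le_sum_abs _ _).trans (Finset.sum_le_sum fun j hj => ?_)))
      · rw [abs_mul, abs_of_nonneg (by positivity : 0 ≤ ((r : ℝ) + 1) * x), mul_assoc _ (E r)]
        refine mul_le_mul_of_nonneg_left ((hΔ r r.lt_succ_self n).trans ?_) (by positivity)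
        exact mul_le_mul_of_nonneg_left
          (succ_pow_sub_pow_mono n (Nat.div_le_div_right r.le_succ)) (hE0 r r.lt_succ_self)
      · have hjr := Finset.mem_range.mp hj
        have hj' : j < r + 1 := by omega
        have hw : ((n : ℝ) + 2) ^ (j / 2) ≤
            ((n : ℝ) + 2) ^ ((r + 1) / 2) - ((n : ℝ) + 1) ^ ((r + 1) / 2) :=
          (pow_le_succ_pow_sub_pow n (j / 2)).trans
            (succ_pow_sub_pow_mono n (by omega : j / 2 + 1 ≤ (r + 1) / 2))
        have h1 : |wMoment a x j (n + 1)| ≤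
            E j * (((n : ℝ) + 2) ^ ((r + 1) / 2) - ((n : ℝ) + 1) ^ ((r + 1) / 2)) := by
          refine (hE j hj' (n + 1)).trans (mul_le_mul_of_nonneg_left ?_ (hE0 j hj'))
          rwa [Nat.cast_succ, show (n : ℝ) + 1 + 1 = n + 2 by ring]
        have h2 : |wMoment a x j n| ≤
            E j * (((n : ℝ) + 2) ^ ((r + 1) / 2) - ((n : ℝ) + 1) ^ ((r + 1) / 2)) := by
          refine (hE j hj' n).trans (mul_le_mul_of_nonneg_left (le_trans ?_ hw) (hE0 j hj'))
          gcongr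
          norm_num
        rw [abs_mul, Nat.abs_cast, mul_assoc, add_mul, mul_assoc, mul_assoc]
        refine mul_le_mul_of_nonneg_left ((abs_add_le _ _).trans ?_) (by positivity)
        rw [abs_mul, abs_mul, abs_pow, abs_neg, abs_of_nonneg hx]
        gcongr
    refine ⟨|wMoment a x (r + 1) 0| + D, by positivity, fun n => ?_, fun n => ?_⟩
    · have hn : |wMoment a x (r + 1) n| ≤
          |wMoment a x (r + 1) 0| + D * (((n : ℝ) + 1) ^ ((r + 1) / 2) - 1) := by
        induction n with
        | zero => simp
        | succ n ihn =>
          have h1 := hdiff n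
          have h2 := abs_sub_abs_le_abs_sub (wMoment a x (r + 1) (n + 1)) (wMoment a x (r + 1) n)
          push_cast
          rw [show (n : ℝ) + 1 + 1 = n + 2 by ring]
          linarith
      have hp : (1 : ℝ) ≤ ((n : ℝ) + 1) ^ ((r + 1) / 2) :=
        one_le_pow₀ (by linarith [n.cast_nonneg (α := ℝ)])
      nlinarith [abs_nonneg (wMoment a x (r + 1) 0)]
    · refine (hdiff n).trans (mul_le_mul_of_nonneg_right
        (le_add_of_nonneg_left (abs_nonneg _)) ?_)
      rw [sub_nonneg]
      gcongr
      norm_num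

theorem integral_sub_pow_eq (n k r : ℕ) (x : ℝ) :
    ((n : ℝ) + 1) ^ (r + 1) *
      ∫ t in ((k : ℝ) / ((n : ℝ) + 1))..(((k : ℝ) + 1) / ((n : ℝ) + 1)), (t - x) ^ r =
    (∑ j ∈ Finset.range (r + 1),
      ((r + 1).choose j : ℝ) * ((k : ℝ) - (n + 1) * x) ^ j) / (r + 1) := by
  have hn : (n : ℝ) + 1 ≠ 0 := by positivity
  rw [intervalIntegral.integral_comp_sub_right (fun t => t ^ r), integral_pow]
  have h := add_pow ((k : ℝ) - (n + 1) * x) 1 (r + 1)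
  rw [Finset.sum_range_succ] at h
  simp only [one_pow, mul_one, Nat.choose_self, Nat.cast_one] at h
  have h' : ∑ j ∈ Finset.range (r + 1),
      ((r + 1).choose j : ℝ) * ((k : ℝ) - (n + 1) * x) ^ j =
      ((k : ℝ) - (n + 1) * x + 1) ^ (r + 1) - ((k : ℝ) - (n + 1) * x) ^ (r + 1) := by
    rw [h, add_sub_cancel_right]
    exact Finset.sum_congr rfl fun j _ => mul_comm _ _
  rw [h', ← mul_div_assoc, mul_sub, ← mul_pow, ← mul_pow]
  congr 3
  · field_simp
    ring
  · field_simp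

theorem uMoment_eq_sum {a : ℝ} (ha : 0 ≤ a) {x : ℝ} (hx : 0 ≤ x) (n r : ℕ) :
    uMoment a n r x = 1 / ((n : ℝ) + 1) ^ r * ((∑ j ∈ Finset.range (r + 1),
      ((r + 1).choose j : ℝ) * wMoment a x j n) / (r + 1)) := by
  have hn : (n : ℝ) + 1 ≠ 0 := by positivity
  have h := ((hasSum_sum (s := Finset.range (r + 1)) fun j _ =>
    (hasSum_wMoment ha hx j n).mul_left ((r + 1).choose j : ℝ)).div_const ((r : ℝ) + 1)).mul_left
      (1 / ((n : ℝ) + 1) ^ (r + 1))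
  rw [uMoment, Kgb, HasSum.tsum_eq (h.congr_fun ?_)]
  · field_simp
    ring
  · intro k
    have hk := integral_sub_pow_eq n k r x
    have hk' : (∫ t in ((k : ℝ) / ((n : ℝ) + 1))..(((k : ℝ) + 1) / ((n : ℝ) + 1)), (t - x) ^ r) =
        1 / ((n : ℝ) + 1) ^ (r + 1) * ((∑ j ∈ Finset.range (r + 1),
          ((r + 1).choose j : ℝ) * ((k : ℝ) - (n + 1) * x) ^ j) / (r + 1)) := by
      rw [← hk]
      field_simp
    rw [hk', mul_left_comm, ← mul_div_assoc, Finset.mul_sum]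
    congr 2
    exact Finset.sum_congr rfl fun j _ => by ring

/-- values of the central moments `u_{n,r}^a` and their
asymptotic order `u_{n,r}^a(x) = O(n^{−⌊(r+1)/2⌋})`
(here `(r+1)/2` is the natural-number floor `⌊(r+1)/2⌋`). -/
theorem statement17 (a : ℝ) (ha : 0 ≤ a) :
    (∀ n : ℕ, ∀ x : ℝ, 0 ≤ x → uMoment a n 0 x = 1) ∧
    (∀ n : ℕ, ∀ x : ℝ, 0 ≤ x →
      uMoment a n 1 x = (1 / ((n : ℝ) + 1)) * (-x + a * x / (1 + x) + 1 / 2)) ∧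
    (∀ n : ℕ, ∀ x : ℝ, 0 ≤ x →
      uMoment a n 2 x = (1 / ((n : ℝ) + 1) ^ 2) *
        ((n : ℝ) * x * (x + 1) - x * (1 - x) +
          (a * x / (1 + x)) * (a * x / (1 + x) + 2 * (1 - x)) + 1 / 3)) ∧
    (∀ x : ℝ, 0 < x → ∀ r : ℕ, ∃ C > (0 : ℝ), ∃ N : ℕ, ∀ n ≥ N,
      |uMoment a n r x| ≤ C / (n : ℝ) ^ ((r + 1) / 2)) := by
  refine ⟨fun n x hx => ?_, fun n x hx => ?_, fun n x hx => ?_, fun x hx r => ?_⟩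
  · simp [uMoment_eq_sum ha hx, wMoment_order_zero ha hx]
  · rw [uMoment_eq_sum ha hx, pow_one]
    congr 1
    simp [Finset.sum_range_succ, wMoment_order_zero ha hx, wMoment_order_one ha hx]
    ring
  · rw [uMoment_eq_sum ha hx]
    congr 1
    simp [Finset.sum_range_succ, wMoment_order_zero ha hx, wMoment_order_one ha hx,
      wMoment_order_two ha hx, Nat.choose]
    ring
  · choose E hE0 hE _ using wMoment_bounds ha hx.le
    set C : ℝ := (∑ j ∈ Finset.range (r + 1), ((r + 1).choose j : ℝ) * E j) / (r + 1) with hC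
    have hC0 : 0 ≤ C :=
      div_nonneg (Finset.sum_nonneg fun j _ => mul_nonneg (by positivity) (hE0 j)) (by positivity)
    refine ⟨C + 1, by positivity, 1, fun n hn => ?_⟩
    have hn0 : (0 : ℝ) < n := by exact_mod_cast hn
    have hsum : |(∑ j ∈ Finset.range (r + 1), ((r + 1).choose j : ℝ) * wMoment a x j n) /
        ((r : ℝ) + 1)| ≤ C * ((n : ℝ) + 1) ^ (r / 2) := by
      rw [abs_div, abs_of_nonneg (by positivity : 0 ≤ (r : ℝ) + 1), hC, div_mul_eq_mul_div,
        Finset.sum_mul]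
      gcongr
      refine (Finset.abs_sum_le_sum_abs _ _).trans (Finset.sum_le_sum fun j hj => ?_)
      have hjr : j ≤ r := Nat.lt_succ_iff.mp (Finset.mem_range.mp hj)
      rw [abs_mul, Nat.abs_cast, mul_assoc]
      refine mul_le_mul_of_nonneg_left ((hE j n).trans
        (mul_le_mul_of_nonneg_left ?_ (hE0 j))) (by positivity)
      exact pow_le_pow_right₀ (by linarith) (Nat.div_le_div_right hjr)
    rw [uMoment_eq_sum ha hx.le, abs_mul, abs_of_nonneg (by positivity)]
    calc _ ≤ 1 / ((n : ℝ) + 1) ^ r * (C * ((n : ℝ) + 1) ^ (r / 2)) := by gcongr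
      _ = C / ((n : ℝ) + 1) ^ ((r + 1) / 2) := by
        have hr : ((n : ℝ) + 1) ^ r = ((n : ℝ) + 1) ^ ((r + 1) / 2) * ((n : ℝ) + 1) ^ (r / 2) := by
          rw [← pow_add]
          congr 1
          omega
        rw [hr]
        field_simp
      _ ≤ (C + 1) / (n : ℝ) ^ ((r + 1) / 2) := by gcongr <;> linarith
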